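/- Let d ≥ 0 be an integer and let h ≥ 656 be the order of a Hadamard matrix such that 16·d³ ≤ h/ln h. Let n = h + d and ε = (4·d·ln h / h)^{1/2}. Then D(n)/h^{n/2} ≥ (2/π)^{d/2} · exp(−2.31·d·ε). -/

import Mathlib

/-- An `h × h` Hadamard matrix: entries in `{−1, 1}` and `A * Aᵀ = h • I`. -/
def IsHadamardMatrix {h : ℕ} (A : Matrix (Fin h) (Fin h) ℝ) : Prop :=
  (∀ i j, A i j = 1 ∨ A i j = -1) ∧ A * A.transpose = (h : ℝ) • 1

/-- `h` is the order of some Hadamard matrix. -/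
def IsHadamardOrder (h : ℕ) : Prop :=
  ∃ A : Matrix (Fin h) (Fin h) ℝ, IsHadamardMatrix A

/-- `maxDet n = D(n)`: the maximum of `|det M|` over `n × n` `{±1}`-matrices `M`. -/
noncomputable def maxDet (n : ℕ) : ℝ :=
  sSup {x : ℝ | ∃ M : Matrix (Fin n) (Fin n) ℝ,
    (∀ i j, M i j = 1 ∨ M i j = -1) ∧ x = |M.det|}

/-- `maxDetBar n = D̄(n) = D(n) / n^(n/2)`. -/
noncomputable def maxDetBar (n : ℕ) : ℝ :=
  maxDet n / (n : ℝ) ^ ((n : ℝ) / 2)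

open Finset in
/-- Averaging a determinant over independent copies of a pair of random vectors `y`, `b` with
cross-covariance proportional to the identity. -/
theorem sum_det_of_biorthogonal {ι κ Ω : Type*} [Fintype ι] [DecidableEq ι] [Fintype κ]
    [DecidableEq κ] [Fintype Ω] (y b : Ω → κ → ℝ) (c : ℝ)
    (hyb : ∀ k l, ∑ w, y w k * b w l = if k = l then c else 0) :
    ∑ w : ι → Ω, (Matrix.of fun i j => ∑ k, y (w i) k * b (w j) k).det =
      c ^ Fintype.card ι * ((Fintype.card κ).descFactorial (Fintype.card ι) : ℝ) := by
  classical
  have expand (w : ι → Ω) : (Matrix.of fun i j => ∑ k, y (w i) k * b (w j) k).det =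
      ∑ σ : Equiv.Perm ι, ∑ k : ι → κ, Equiv.Perm.sign σ •
        ∏ i, (y (w i) (k (σ⁻¹ i)) * b (w i) (k i)) := by
    rw [Matrix.det_apply]
    refine sum_congr rfl fun σ _ => ?_
    rw [← smul_sum]
    congr 1
    simp only [Matrix.of_apply]
    rw [prod_univ_sum, Fintype.piFinset_univ]
    refine sum_congr rfl fun k _ => ?_
    rw [prod_mul_distrib, prod_mul_distrib]
    congr 1
    rw [← Equiv.prod_comp σ (fun i => y (w i) (k (σ⁻¹ i)))]
    simp
  have average (σ : Equiv.Perm ι) (k : ι → κ) :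
      ∑ w : ι → Ω, ∏ i, (y (w i) (k (σ⁻¹ i)) * b (w i) (k i)) =
        c ^ Fintype.card ι * ∏ i, (if k (σ i) = k i then (1 : ℝ) else 0) := by
    have h := prod_univ_sum (fun _ : ι => (univ : Finset Ω))
      (fun i w => y w (k (σ⁻¹ i)) * b w (k i))
    rw [Fintype.piFinset_univ] at h
    rw [← h]
    simp only [hyb]
    rw [← Equiv.prod_comp σ, ← card_univ, ← prod_const, ← prod_mul_distrib]
    refine prod_congr rfl fun i _ => ?_
    simp [eq_comm]
  have gram (k : ι → κ) :
      (Matrix.of fun i j => if k i = k j then (1 : ℝ) else 0).det =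
        if Function.Injective k then 1 else 0 := by
    split_ifs with hk
    · convert Matrix.det_one (n := ι) (R := ℝ)
      ext i j
      simp [Matrix.one_apply, hk.eq_iff]
    · simp only [Function.Injective, not_forall] at hk
      obtain ⟨i, j, hij, hne⟩ := hk
      refine Matrix.det_zero_of_row_eq hne ?_
      ext l
      simp [hij]
  calc _ = ∑ k : ι → κ, c ^ Fintype.card ι *
        (Matrix.of fun i j => if k i = k j then (1 : ℝ) else 0).det := by
        simp only [expand]
        rw [sum_comm]
        simp only [Matrix.det_apply, mul_sum]
        rw [sum_comm (s := (univ : Finset (ι → κ)))]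
        refine sum_congr rfl fun σ _ => ?_
        rw [sum_comm]
        refine sum_congr rfl fun k _ => ?_
        rw [← smul_sum, average, mul_smul_comm]
        rfl
    _ = _ := by
        simp only [gram]
        rw [← mul_sum, sum_boole, ← Fintype.card_embedding_eq, ← Fintype.card_subtype,
          Fintype.card_congr (Equiv.subtypeInjectiveEquivEmbedding ι κ)]

/-- Some `±1` perturbation does not decrease the absolute value of a determinant. -/
theorem exists_sign_le_abs_det_add {ι : Type*} [Fintype ι] [DecidableEq ι] (N : Matrix ι ι ℝ) :
    ∃ D : Matrix ι ι ℝ, (∀ i j, D i j = 1 ∨ D i j = -1) ∧ |N.det| ≤ |(D + N).det| := by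
  classical
  by_contra! hlt
  let s : Bool → ℝ := fun t => if t then 1 else -1
  have hs (t) : s t = 1 ∨ s t = -1 := by cases t <;> simp [s]
  let P (r : ι → Bool) : Matrix ι ι ℝ := (Matrix.of fun i _ => s (r i)) + N
  have key : (2 : ℝ) ^ Fintype.card ι * N.det = ∑ r : ι → Bool, (P r).det := by
    have h := (Matrix.detRowAlternating (n := ι) (R := ℝ)).toMultilinearMap.map_sum
      (fun i (t : Bool) => (fun j => s t + N i j : ι → ℝ))
    have e : (fun i => ∑ t : Bool, (fun j => s t + N i j : ι → ℝ)) = (2 : ℝ) • N := by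
      ext i j
      simp [s]
      ring
    rw [e] at h
    rw [← Matrix.det_smul]
    exact h
  have h1 : |∑ r : ι → Bool, (P r).det| < ∑ _r : ι → Bool, |N.det| :=
    (Finset.abs_sum_le_sum_abs _ _).trans_lt
      (Finset.sum_lt_sum_of_nonempty Finset.univ_nonempty fun r _ =>
        hlt _ fun i _ => hs (r i))
  rw [← key, abs_mul] at h1
  simp at h1

/-- The total absolute value of all sums of `2 * m` signs. -/
theorem sum_abs_sum_signs (m : ℕ) :
    ∑ u : Fin (2 * m) → ℤˣ, |∑ i, (((u i : ℤˣ) : ℤ) : ℝ)| = 2 * m * (m.centralBinom : ℝ) := by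
  classical
  have reduce : ∑ u : Fin (2 * m) → ℤˣ, |∑ i, (((u i : ℤˣ) : ℤ) : ℝ)| =
      ∑ k ∈ Finset.range (2 * m + 1), ((2 * m).choose k : ℝ) * |2 * (k : ℝ) - 2 * m| := by
    have h := Finset.sum_powerset_apply_card (fun k => |2 * (k : ℝ) - 2 * m|)
      (x := (Finset.univ : Finset (Fin (2 * m))))
    simp only [Finset.card_univ, Fintype.card_fin, nsmul_eq_mul, Finset.powerset_univ] at h
    rw [← h]
    symm
    refine Fintype.sum_bijective
      (fun (S : Finset (Fin (2 * m))) i => if i ∈ S then (1 : ℤˣ) else -1) ⟨?_, ?_⟩ _ _ ?_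
    · intro S T hST
      ext i
      have := congrFun hST i
      by_cases h1 : i ∈ S <;> by_cases h2 : i ∈ T <;> simp_all
    · intro u
      refine ⟨Finset.univ.filter fun i => u i = 1, ?_⟩
      ext i
      rcases Int.units_eq_one_or (u i) with hu | hu <;> simp [hu]
    · intro S
      congr 1
      have (i : Fin (2 * m)) : (((if i ∈ S then (1 : ℤˣ) else -1 : ℤˣ) : ℤ) : ℝ) =
          2 * (if i ∈ S then 1 else 0) - 1 := by
        split_ifs <;> norm_num
      simp only [this]
      rw [Finset.sum_sub_distrib, ← Finset.mul_sum]
      simp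
  have partial_sum (j : ℕ) : ∑ k ∈ Finset.range j, ((2 * m).choose k : ℝ) * (2 * m - 2 * k) =
      j * ((2 * m).choose j : ℝ) := by
    induction j with
    | zero => simp
    | succ j ih =>
      rw [Finset.sum_range_succ, ih]
      rcases le_or_gt j (2 * m) with hj | hj
      · have := Nat.choose_succ_right_eq (2 * m) j
        zify [hj] at this
        have h' : ((2 * m).choose (j + 1) : ℝ) * (j + 1) = (2 * m).choose j * (2 * m - j) := by
          exact_mod_cast this
        push_cast
        linarith
      · simp [Nat.choose_eq_zero_of_lt hj, Nat.choose_eq_zero_of_lt (hj.trans (Nat.lt_succ_self j))]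
  have split (k : ℕ) : ((2 * m).choose k : ℝ) * |2 * (k : ℝ) - 2 * m| =
      2 * (if k < m then ((2 * m).choose k : ℝ) * (2 * m - 2 * k) else 0) -
        ((2 * m).choose k : ℝ) * (2 * m - 2 * k) := by
    split_ifs with hk
    · have : (k : ℝ) < m := by exact_mod_cast hk
      rw [abs_of_nonpos (by linarith)]
      ring
    · have : (m : ℝ) ≤ k := by exact_mod_cast not_lt.mp hk
      rw [abs_of_nonneg (by linarith)]
      ring
  rw [reduce, Finset.sum_congr rfl fun k _ => split k, Finset.sum_sub_distrib, ← Finset.mul_sum,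
    partial_sum, ← Finset.sum_filter]
  have : (Finset.range (2 * m + 1)).filter (· < m) = Finset.range m := by
    ext k
    simp
    omega
  rw [this, partial_sum, Nat.centralBinom_eq_two_mul_choose]
  simp
  ring

theorem two_div_pi_le_sq_centralBinom (m : ℕ) :
    2 / (Real.pi * (2 * m + 1)) ≤ ((m.centralBinom : ℝ) / 4 ^ m) ^ 2 := by
  have hW := Real.Wallis.W_le m
  rw [Real.Wallis.W_eq_factorial_ratio] at hW
  have hc : (m.centralBinom : ℝ) * (m.factorial : ℝ) ^ 2 = (2 * m).factorial := by
    have := Nat.choose_mul_factorial_mul_factorial (show m ≤ 2 * m by omega)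
    rw [Nat.centralBinom_eq_two_mul_choose, ← this, show 2 * m - m = m by omega]
    push_cast
    ring
  have hm : (0 : ℝ) < m.factorial := by positivity
  have hC : (0 : ℝ) < m.centralBinom := by exact_mod_cast m.centralBinom_pos
  have e : (2 : ℝ) ^ (4 * m) = (4 ^ m) ^ 2 := by
    rw [← pow_mul, show (4 : ℝ) = 2 ^ 2 by norm_num, ← pow_mul]
    ring_nf
  rw [← hc, e, div_le_div_iff₀ (by positivity) (by norm_num)] at hW
  rw [div_pow, div_le_div_iff₀ (by positivity) (by positivity)]
  have h4 : (0 : ℝ) < (m.factorial : ℝ) ^ 4 := by positivity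
  refine le_of_mul_le_mul_right ?_ h4
  nlinarith

theorem IsHadamardMatrix.even {h : ℕ} {A : Matrix (Fin h) (Fin h) ℝ} (hA : IsHadamardMatrix A)
    (hh : 2 ≤ h) : Even h := by
  classical
  have h01 : (⟨0, by omega⟩ : Fin h) ≠ ⟨1, by omega⟩ := by simp
  have orth := congrFun (congrFun hA.2 ⟨0, by omega⟩) ⟨1, by omega⟩
  rw [Matrix.mul_apply, Matrix.smul_apply, Matrix.one_apply_ne h01] at orth
  simp only [Matrix.transpose_apply, smul_zero] at orth
  have entry (j : Fin h) : A ⟨0, by omega⟩ j * A ⟨1, by omega⟩ j =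
      2 * (if A ⟨0, by omega⟩ j = A ⟨1, by omega⟩ j then 1 else 0) - 1 := by
    rcases hA.1 ⟨0, by omega⟩ j with h0 | h0 <;> rcases hA.1 ⟨1, by omega⟩ j with h1 | h1 <;>
      rw [h0, h1] <;> norm_num
  simp only [entry] at orth
  rw [Finset.sum_sub_distrib, ← Finset.mul_sum, Finset.sum_boole] at orth
  simp only [Finset.sum_const, Finset.card_univ, Fintype.card_fin, nsmul_eq_mul, mul_one] at orth
  rw [even_iff_exists_two_mul]
  exact ⟨_, by exact_mod_cast (sub_eq_zero.mp orth).symm⟩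

/-- The sign of a real number, with the convention that the sign of zero is `1`. -/
noncomputable def signOne (x : ℝ) : ℝ := if 0 ≤ x then 1 else -1

theorem signOne_eq_or (x : ℝ) : signOne x = 1 ∨ signOne x = -1 := by
  unfold signOne
  split_ifs <;> simp

theorem signOne_mul_self (x : ℝ) : signOne x * x = |x| := by
  unfold signOne
  split_ifs with h
  · rw [one_mul, abs_of_nonneg h]
  · rw [abs_of_neg (not_le.mp h), neg_one_mul]

theorem sum_signOne_sum_mul {m : ℕ} (l : Fin (2 * m)) :
    ∑ u : Fin (2 * m) → ℤˣ, signOne (∑ i, (((u i : ℤˣ) : ℤ) : ℝ)) * (((u l : ℤˣ) : ℤ) : ℝ) =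
      m.centralBinom := by
  classical
  have const (l' : Fin (2 * m)) :
      ∑ u : Fin (2 * m) → ℤˣ,
          signOne (∑ i, (((u i : ℤˣ) : ℤ) : ℝ)) * (((u l' : ℤˣ) : ℤ) : ℝ) =
        ∑ u : Fin (2 * m) → ℤˣ,
          signOne (∑ i, (((u i : ℤˣ) : ℤ) : ℝ)) * (((u l : ℤˣ) : ℤ) : ℝ) := by
    refine Fintype.sum_equiv ((Equiv.swap l l').arrowCongr (Equiv.refl ℤˣ)) _ _ fun u => ?_
    have e := Equiv.sum_comp (Equiv.swap l l') fun i => (((u i : ℤˣ) : ℤ) : ℝ)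
    simp [Equiv.arrowCongr, e]
  have total := sum_abs_sum_signs m
  simp only [← signOne_mul_self, Finset.mul_sum] at total
  rw [Finset.sum_comm, Finset.sum_congr rfl fun l' _ => const l'] at total
  simp only [Finset.sum_const, Finset.card_univ, Fintype.card_fin, nsmul_eq_mul] at total
  have hm : ((2 * m : ℕ) : ℝ) ≠ 0 := by
    have := l.pos
    positivity
  refine mul_left_cancel₀ hm ?_
  rw [total]
  push_cast
  ring

/-- For a Hadamard matrix `A`, the random vectors `A * sign (Aᵀ * u)` and `u`
have cross-covariance proportional to the identity. -/
theorem IsHadamardMatrix.sum_signOne_biorthogonal {m : ℕ}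
    {A : Matrix (Fin (2 * m)) (Fin (2 * m)) ℝ} (hA : IsHadamardMatrix A) (k l : Fin (2 * m)) :
    ∑ u : Fin (2 * m) → ℤˣ,
        (∑ j, A k j * signOne (∑ i, A i j * (((u i : ℤˣ) : ℤ) : ℝ))) * (((u l : ℤˣ) : ℤ) : ℝ) =
      if k = l then (2 * m * m.centralBinom : ℝ) else 0 := by
  have lift (j : Fin (2 * m)) : ∃ a : Fin (2 * m) → ℤˣ, ∀ i, A i j = (((a i : ℤˣ) : ℤ) : ℝ) := by
    have signs (i : Fin (2 * m)) : ∃ a : ℤˣ, A i j = ((a : ℤ) : ℝ) := by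
      rcases hA.1 i j with h | h
      · exact ⟨1, by simp [h]⟩
      · exact ⟨-1, by simp [h]⟩
    choose a ha using signs
    exact ⟨a, ha⟩
  have column (j : Fin (2 * m)) :
      ∑ u : Fin (2 * m) → ℤˣ,
          signOne (∑ i, A i j * (((u i : ℤˣ) : ℤ) : ℝ)) * (((u l : ℤˣ) : ℤ) : ℝ) =
        A l j * m.centralBinom := by
    obtain ⟨a, ha⟩ := lift j
    rw [← sum_signOne_sum_mul l, Finset.mul_sum]
    refine Fintype.sum_equiv (Equiv.mulLeft a) _ _ fun u => ?_
    have hsq : A l j * A l j = 1 := by rcases hA.1 l j with h | h <;> rw [h] <;> norm_num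
    simp only [Equiv.coe_mulLeft, Pi.mul_apply, Units.val_mul, Int.cast_mul, ← ha]
    linear_combination (-(signOne (∑ i, A i j * (((u i : ℤˣ) : ℤ) : ℝ)) *
      (((u l : ℤˣ) : ℤ) : ℝ))) * hsq
  simp only [Finset.sum_mul]
  rw [Finset.sum_comm]
  simp only [mul_assoc, ← Finset.mul_sum, column]
  have orth := congrFun (congrFun hA.2 k) l
  rw [Matrix.mul_apply, Matrix.smul_apply, Matrix.one_apply] at orth
  simp only [Matrix.transpose_apply] at orth
  simp only [← mul_assoc, ← Finset.sum_mul, orth]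
  split_ifs <;> simp

theorem abs_det_le_maxDet {ι : Type*} [Fintype ι] [DecidableEq ι] {n : ℕ}
    (hn : Fintype.card ι = n) (M : Matrix ι ι ℝ) (hM : ∀ i j, M i j = 1 ∨ M i j = -1) :
    |M.det| ≤ maxDet n := by
  let e := Fintype.equivFinOfCardEq hn
  refine le_csSup ⟨(n.factorial : ℝ), ?_⟩ ⟨Matrix.reindex e e M, fun i j => ?_, ?_⟩
  · rintro x ⟨N, hN, rfl⟩
    have := Matrix.det_le (A := N) (abv := AbsoluteValue.abs) (x := 1) fun i j => by
      rcases hN i j with h | h <;> simp [h]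
    simpa using this
  · simpa using hM (e.symm i) (e.symm j)
  · rw [Matrix.det_reindex_self]

theorem IsHadamardMatrix.abs_det {h : ℕ} {A : Matrix (Fin h) (Fin h) ℝ}
    (hA : IsHadamardMatrix A) : |A.det| = Real.sqrt h ^ h := by
  have hdet := congrArg Matrix.det hA.2
  rw [Matrix.det_mul, Matrix.det_transpose, Matrix.det_smul, Matrix.det_one, mul_one,
    Fintype.card_fin] at hdet
  rw [← sq_eq_sq₀ (abs_nonneg _) (by positivity), sq_abs, ← pow_mul, mul_comm h 2, pow_mul,
    Real.sq_sqrt (Nat.cast_nonneg h), sq, hdet]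

/-- Bordering a Hadamard matrix by `d` random columns and correlated rows. -/
theorem IsHadamardMatrix.le_maxDet_add {m d : ℕ} (hm : 0 < m)
    {A : Matrix (Fin (2 * m)) (Fin (2 * m)) ℝ} (hA : IsHadamardMatrix A) :
    Real.sqrt (2 * m : ℕ) ^ (2 * m) *
        (((m.centralBinom : ℝ) / 4 ^ m) ^ d * ((2 * m).descFactorial d : ℝ)) ≤
      maxDet (2 * m + d) := by
  classical
  have hm' : (0 : ℝ) < m := by exact_mod_cast hm
  let C (w : Fin d → Fin (2 * m) → ℤˣ) : Matrix (Fin d) (Fin (2 * m)) ℝ :=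
    Matrix.of fun i j => signOne (∑ k, A k j * (((w i k : ℤˣ) : ℤ) : ℝ))
  let B (w : Fin d → Fin (2 * m) → ℤˣ) : Matrix (Fin (2 * m)) (Fin d) ℝ :=
    Matrix.of fun k j => (((w j k : ℤˣ) : ℤ) : ℝ)
  have avg := sum_det_of_biorthogonal (ι := Fin d) _ _ _ hA.sum_signOne_biorthogonal
  have gram (w : Fin d → Fin (2 * m) → ℤˣ) : C w * A.transpose * B w =
      Matrix.of fun i j => ∑ k, (∑ j, A k j * signOne (∑ l, A l j * (((w i l : ℤˣ) : ℤ) : ℝ))) *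
        (((w j k : ℤˣ) : ℤ) : ℝ) := by
    ext i j
    simp [C, B, Matrix.mul_apply, mul_comm]
  simp only [← gram, Fintype.card_fin] at avg
  obtain ⟨w, hw⟩ : ∃ w, (2 * m * ((m.centralBinom : ℝ) / 4 ^ m)) ^ d *
      ((2 * m).descFactorial d : ℝ) ≤ (C w * A.transpose * B w).det := by
    obtain ⟨w, -, hw⟩ := Finset.exists_le_of_sum_le
      (s := (Finset.univ : Finset (Fin d → Fin (2 * m) → ℤˣ)))
      (f := fun _ => (2 * m * ((m.centralBinom : ℝ) / 4 ^ m)) ^ d *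
        ((2 * m).descFactorial d : ℝ))
      (g := fun w => (C w * A.transpose * B w).det) Finset.univ_nonempty (by
        rw [avg, Finset.sum_const, Finset.card_univ]
        simp only [Fintype.card_fun, Fintype.card_fin, Fintype.card_units_int, nsmul_eq_mul]
        rw [← mul_assoc]
        push_cast
        rw [← mul_pow]
        refine le_of_eq ?_
        congr 2
        rw [pow_mul]
        norm_num
        field_simp)
    exact ⟨w, hw⟩
  have inv : A * ((2 * m : ℝ)⁻¹ • A.transpose) = 1 := by
    rw [Matrix.mul_smul, hA.2, smul_smul]
    push_cast
    rw [inv_mul_cancel₀ (by positivity), one_smul]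
  let _ : Invertible A := ⟨(2 * m : ℝ)⁻¹ • A.transpose, mul_eq_one_comm.mp inv, inv⟩
  have hinv : ⅟A = (2 * m : ℝ)⁻¹ • A.transpose := rfl
  obtain ⟨D, hD, hdet⟩ := exists_sign_le_abs_det_add (-(C w * ⅟A * B w))
  have entries : ∀ i j, Matrix.fromBlocks A (B w) (C w) D i j = 1 ∨
      Matrix.fromBlocks A (B w) (C w) D i j = -1 := by
    rintro (i | i) (j | j)
    · exact hA.1 i j
    · rcases Int.units_eq_one_or (w j i) with h | h <;> simp [B, h]
    · exact signOne_eq_or _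
    · exact hD i j
  refine le_trans ?_ (abs_det_le_maxDet (by simp) _ entries)
  rw [Matrix.det_fromBlocks₁₁, abs_mul, hA.abs_det, sub_eq_add_neg]
  refine mul_le_mul_of_nonneg_left (le_trans ?_ hdet) (by positivity)
  rw [Matrix.det_neg, abs_mul, abs_pow, abs_neg, abs_one, one_pow, one_mul, hinv,
    Matrix.mul_smul, Matrix.smul_mul, Matrix.det_smul, Fintype.card_fin]
  refine le_trans ?_ (le_abs_self _)
  refine le_trans (le_of_eq ?_) (mul_le_mul_of_nonneg_left hw (by positivity))
  rw [← mul_assoc, ← mul_pow]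
  congr 2
  field_simp

theorem exp_neg_sqrt_le_one_sub_sq {x L ε : ℝ} (hx0 : 0 ≤ x) (hx : x ≤ 1 / 16) (hL : 1 ≤ L)
    (hε : ε = Real.sqrt (4 * x * L)) : Real.exp (-2.31 * ε) ≤ (1 - x) ^ 2 := by
  have h2x : 2 * x ≤ ε := by
    rw [hε]
    refine Real.le_sqrt_of_sq_le ?_
    nlinarith [mul_le_mul_of_nonneg_left hL hx0]
  have hpos : 0 < 1 + 4.62 * x := by positivity
  calc Real.exp (-2.31 * ε) ≤ Real.exp (-(4.62 * x)) := Real.exp_le_exp.mpr (by linarith)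
    _ ≤ (1 + 4.62 * x)⁻¹ := by
        rw [Real.exp_neg]
        exact inv_anti₀ hpos (by linarith [Real.add_one_le_exp (4.62 * x)])
    _ ≤ (1 - x) ^ 2 := by
        rw [inv_le_iff_one_le_mul₀ hpos]
        nlinarith [mul_nonneg hx0 hx0, mul_nonneg hx0 (mul_nonneg hx0 hx0)]

theorem maxDet_lower_bound_two (d h n : ℕ) (hH : IsHadamardOrder h) (hh : 656 ≤ h)
    (hdh : 16 * (d : ℝ) ^ 3 ≤ (h : ℝ) / Real.log h)
    (hn : n = h + d) (ε : ℝ) (hε : ε = Real.sqrt (4 * (d : ℝ) * Real.log h / (h : ℝ))) :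
    maxDet n / (h : ℝ) ^ ((n : ℝ) / 2) ≥
      (2 / Real.pi) ^ ((d : ℝ) / 2) * Real.exp (-2.31 * (d : ℝ) * ε) := by
  obtain ⟨A, hA⟩ := hH
  obtain ⟨m, rfl⟩ := even_iff_exists_two_mul.mp (hA.even (by omega))
  subst hn
  set h : ℕ := 2 * m with hdef
  have hbig : (656 : ℝ) ≤ h := by exact_mod_cast hh
  have hh0 : (0 : ℝ) < h := by linarith
  have hlog : 1 ≤ Real.log h := by
    rw [Real.le_log_iff_exp_le hh0]
    linarith [Real.exp_one_lt_d9]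
  have bound := hA.le_maxDet_add (d := d) (by omega)
  rw [← hdef] at bound
  have key : Real.sqrt (2 / Real.pi) ^ d * Real.exp (-2.31 * ε) ^ d * Real.sqrt h ^ d ≤
      ((m.centralBinom : ℝ) / 4 ^ m) ^ d * (h.descFactorial d : ℝ) := by
    rcases Nat.eq_zero_or_pos d with rfl | hd
    · simp
    have hd1 : (1 : ℝ) ≤ d := by exact_mod_cast hd
    have hd16 : 16 * (d : ℝ) ≤ h := by
      have h1 : (d : ℝ) ≤ d ^ 3 := le_self_pow₀ hd1 (by norm_num)
      have h2 : (h : ℝ) / Real.log h ≤ h := div_le_self hh0.le hlog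
      linarith
    have hdle : d ≤ h := by
      have : (d : ℝ) ≤ h := by linarith
      exact_mod_cast this
    have hdesc : ((h : ℝ) - d) ^ d ≤ (h.descFactorial d : ℝ) := by
      have h1 : (h - d) ^ d ≤ h.descFactorial d :=
        (Nat.pow_le_pow_left (by omega) d).trans (Nat.pow_sub_le_descFactorial h d)
      rw [← Nat.cast_sub hdle]
      exact_mod_cast h1
    set x : ℝ := d / h with hx
    have hexp := exp_neg_sqrt_le_one_sub_sq (x := x) (by positivity)
      (by rw [hx, div_le_iff₀ hh0]; linarith) hlog (hε.trans (by rw [hx]; congr 1; ring))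
    have hx1 : 0 ≤ 1 - x := by
      rw [hx, sub_nonneg, div_le_one hh0]
      linarith
    have hhx : (h : ℝ) - d = h * (1 - x) := by
      rw [hx]
      field_simp
    have hcentral : Real.sqrt (2 / Real.pi) * (1 - x) * Real.sqrt h ≤
        (m.centralBinom : ℝ) / 4 ^ m * h := by
      refine abs_le_of_sq_le_sq' ?_ (by positivity) |>.2
      have hw := two_div_pi_le_sq_centralBinom m
      have hcast : (2 * m + 1 : ℝ) = h + 1 := by rw [hdef]; push_cast; ring
      rw [hcast] at hw
      rw [mul_pow, mul_pow, mul_pow, Real.sq_sqrt (by positivity), Real.sq_sqrt hh0.le]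
      refine le_trans ?_ (mul_le_mul_of_nonneg_right hw (by positivity))
      have hx2 : (1 - x) * (h + 1) ≤ h := by
        have : x * h = d := by rw [hx]; field_simp
        nlinarith [show 0 ≤ x by positivity]
      have hx3 : (1 - x) ^ 2 * (h + 1) ≤ h := by
        nlinarith [show 0 ≤ x by positivity]
      rw [div_mul_eq_mul_div, div_mul_eq_mul_div, div_mul_eq_mul_div,
        div_le_div_iff₀ Real.pi_pos (by positivity)]
      nlinarith [mul_le_mul_of_nonneg_left hx3 (show 0 ≤ 2 * h * Real.pi by positivity)]
    calc _ = (Real.sqrt (2 / Real.pi) * Real.exp (-2.31 * ε) * Real.sqrt h) ^ d := by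
          rw [mul_pow, mul_pow]
      _ ≤ ((m.centralBinom : ℝ) / 4 ^ m * ((h : ℝ) - d)) ^ d := by
          refine pow_le_pow_left₀ (by positivity) ?_ d
          rw [hhx]
          calc _ ≤ Real.sqrt (2 / Real.pi) * (1 - x) ^ 2 * Real.sqrt h := by gcongr
            _ = Real.sqrt (2 / Real.pi) * (1 - x) * Real.sqrt h * (1 - x) := by ring
            _ ≤ (m.centralBinom : ℝ) / 4 ^ m * h * (1 - x) :=
                mul_le_mul_of_nonneg_right hcentral hx1
            _ = _ := by ring
      _ ≤ _ := by
          rw [mul_pow]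
          gcongr
  have half_pow (y : ℝ) (hy : 0 ≤ y) (k : ℕ) : y ^ ((k : ℝ) / 2) = Real.sqrt y ^ k := by
    rw [Real.sqrt_eq_rpow, ← Real.rpow_natCast, ← Real.rpow_mul hy]
    congr 1
    ring
  rw [ge_iff_le, half_pow _ hh0.le, half_pow _ (by positivity), le_div_iff₀ (by positivity),
    show -2.31 * (d : ℝ) * ε = d * (-2.31 * ε) by ring, Real.exp_nat_mul, pow_add]
  calc _ = Real.sqrt h ^ h * (Real.sqrt (2 / Real.pi) ^ d * Real.exp (-2.31 * ε) ^ d *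
        Real.sqrt h ^ d) := by ring
    _ ≤ _ := mul_le_mul_of_nonneg_left key (by positivity)
    _ ≤ _ := bound
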